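/- (Equilibrium characterization for the initialization-free distributed algorithm over connected undirected graphs.) For i = 1,…,N let f_i : ℝⁿ → ℝ be convex, let Ω_i ⊆ ℝⁿ be nonempty closed convex, let d_i ∈ ℝⁿ, and assume Slater's condition. Let L be a real symmetric N×N matrix with L·1_N = 0 whose kernel is the span of 1_N (Laplacian of a connected undirected graph), and let k₁, k₂, k₃ > 0. Then for a family y* = (y_1*,…,y_N*) in ℝⁿ the following are equivalent: (A) there exist families x* = (x_i*), s* = (s_i*), w* = (w_i*) in ℝⁿ such that for every i: (i) there is a subgradient g_i of f_i at y_i* with 0 = y_i* − x_i* − g_i + s_i*; (ii) k₁((Lw*)_i − y_i* + d_i) = k₂·(Ls*)_i; (iii) Σ_j L_ij ((Lw*)_j − y_j* + d_j) = 0; (iv) y_i* = P_{Ω_i}(x_i*), i.e., y_i* ∈ Ω_i and ‖x_i* − y_i*‖ ≤ ‖x_i* − z‖ for all z ∈ Ω_i; (B) y* is an optimal solution of the resource allocation problem. -/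

import Mathlib

open RealInnerProductSpace

section Separation

variable {E : Type*} [NormedAddCommGroup E] [InnerProductSpace ℝ E] [FiniteDimensional ℝ E]

theorem exists_inner_add_mul_of_strongDual_prod (φ : StrongDual ℝ (E × ℝ)) :
    ∃ (a : E) (b : ℝ), ∀ z r, φ (z, r) = ⟪a, z⟫ + b * r := by
  have := FiniteDimensional.complete ℝ E
  refine ⟨(InnerProductSpace.toDual ℝ E).symm (φ.comp (ContinuousLinearMap.inl ℝ E ℝ)),
    φ (0, 1), fun z r => ?_⟩
  rw [InnerProductSpace.toDual_symm_apply]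
  have h : ((z, r) : E × ℝ) = (z, 0) + r • (0, 1) := by simp
  rw [h, map_add, map_smul]
  simp [mul_comm]

theorem ConvexOn.continuous_of_univ {V : Type*} [NormedAddCommGroup V] [NormedSpace ℝ V]
    [FiniteDimensional ℝ V] {F : V → ℝ} (hF : ConvexOn ℝ Set.univ F) : Continuous F :=
  continuousOn_univ.mp (hF.continuousOn isOpen_univ)

/-- Lagrange multipliers for a convex problem with a linear equality constraint, under Slater's
condition. -/
theorem ConvexOn.exists_lagrange_multiplier {V : Type*} [NormedAddCommGroup V] [NormedSpace ℝ V]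
    [FiniteDimensional ℝ V] {F : V → ℝ} (hF : ConvexOn ℝ Set.univ F) {K : Set V}
    (hK : Convex ℝ K) {A : V →ₗ[ℝ] E} (hA : Function.Surjective A) {b : E} {x : V}
    (hx : x ∈ interior K) (hxb : A x = b) {m : ℝ} (hm : ∀ z ∈ K, A z = b → m ≤ F z) :
    ∃ s : E, ∀ z ∈ K, m + ⟪s, A z - b⟫ ≤ F z := by
  have hcont : Continuous F := hF.continuous_of_univ
  have hAc : Continuous A := A.continuous_of_finiteDimensional
  set U : Set (V × ℝ) := {p | p.1 ∈ interior K ∧ F p.1 < p.2}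
  have hUopen : IsOpen U :=
    (isOpen_interior.preimage continuous_fst).inter
      (isOpen_lt (hcont.comp continuous_fst) continuous_snd)
  have hUconv : Convex ℝ U :=
    (hF.subset (Set.subset_univ _) hK.interior).convex_strict_epigraph
  let T : V × ℝ →ₗ[ℝ] E × ℝ := A.prodMap LinearMap.id
  have hT : Function.Surjective T := hA.prodMap Function.surjective_id
  have hnot : (b, m) ∉ T '' U := by
    rintro ⟨⟨z, r⟩, ⟨hz, hr⟩, h⟩
    obtain ⟨h₁, h₂⟩ := Prod.mk.inj h
    change r = m at h₂
    have := hm z (interior_subset hz) h₁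
    simp only at hr
    linarith
  obtain ⟨φ, hφ⟩ := geometric_hahn_banach_open_point (hUconv.linear_image T)
    (T.isOpenMap_of_finiteDimensional hT _ hUopen) hnot
  obtain ⟨a, c, hac⟩ := exists_inner_add_mul_of_strongDual_prod φ
  have key : ∀ z ∈ interior K, ∀ r, F z < r → ⟪a, A z⟫ + c * r < ⟪a, b⟫ + c * m := by
    intro z hz r hr
    have := hφ (A z, r) ⟨(z, r), ⟨hz, hr⟩, rfl⟩
    rwa [hac, hac] at this
  have hc : c < 0 := by
    have h := key x hx (max (F x) m + 1) (by linarith [le_max_left (F x) m])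
    rw [hxb] at h
    by_contra! hc
    nlinarith [le_max_right (F x) m]
  refine ⟨(-c)⁻¹ • a, ?_⟩
  have hint : ∀ z ∈ interior K, m + ⟪(-c)⁻¹ • a, A z - b⟫ ≤ F z := by
    intro z hz
    refine le_of_forall_gt_imp_ge_of_dense fun r hr => ?_
    have h := key z hz r hr
    rw [real_inner_smul_left, inner_sub_right, ← sub_nonneg]
    have : r - (m + (-c)⁻¹ * (⟪a, A z⟫ - ⟪a, b⟫))
        = (-c)⁻¹ * (⟪a, b⟫ + c * m - (⟪a, A z⟫ + c * r)) := by
      have := hc.ne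
      field_simp
      ring
    rw [this]
    exact mul_nonneg (inv_nonneg.2 (by linarith)) (by linarith)
  intro z hz
  have hcl : IsClosed {z | m + ⟪(-c)⁻¹ • a, A z - b⟫ ≤ F z} :=
    isClosed_le (by fun_prop) hcont
  refine closure_minimal hint hcl ?_
  rw [hK.closure_interior_eq_closure_of_nonempty_interior ⟨x, hx⟩]
  exact subset_closure hz

/-- If a convex function stays above an affine function with slope `s` on a convex set `K`, with
equality at `y ∈ K`, then `s` is the sum of a subgradient at `y` and an element of the normal cone
of `K` at `y`. -/
theorem ConvexOn.exists_subgradient_of_le_on {F : E → ℝ} (hF : ConvexOn ℝ Set.univ F) {K : Set E}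
    (hK : Convex ℝ K) {y s : E} (hy : y ∈ K) (hs : ∀ z ∈ K, F y + ⟪s, z - y⟫ ≤ F z) :
    ∃ g : E, (∀ z, F y + ⟪g, z - y⟫ ≤ F z) ∧ ∀ z ∈ K, ⟪s - g, z - y⟫ ≤ 0 := by
  have hcont : Continuous F := hF.continuous_of_univ
  set U : Set (E × ℝ) := {p | p.1 ∈ Set.univ ∧ F p.1 < p.2}
  have hUopen : IsOpen U := by
    simpa [U] using isOpen_lt (hcont.comp continuous_fst) continuous_snd
  set B : Set (E × ℝ) := {p | p.1 ∈ K ∧ p.2 ≤ F y + ⟪s, p.1 - y⟫}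
  have hB : Convex ℝ B := by
    rintro ⟨z, r⟩ ⟨hz, hr⟩ ⟨z', r'⟩ ⟨hz', hr'⟩ α β hα hβ hαβ
    refine ⟨hK hz hz' hα hβ hαβ, ?_⟩
    simp only [Prod.smul_mk, Prod.mk_add_mk, smul_eq_mul, inner_sub_right, inner_add_right,
      real_inner_smul_right] at hr hr' ⊢
    have h := add_le_add (mul_le_mul_of_nonneg_left hr hα) (mul_le_mul_of_nonneg_left hr' hβ)
    obtain rfl : β = 1 - α := by linarith
    linarith
  have hdisj : Disjoint U B := by
    rw [Set.disjoint_left]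
    rintro ⟨z, r⟩ ⟨-, hr⟩ ⟨hz, hr'⟩
    have := hs z hz
    simp only at hr hr'
    linarith
  obtain ⟨φ, u, hφU, hφB⟩ := geometric_hahn_banach_open hF.convex_strict_epigraph hUopen hB hdisj
  obtain ⟨a, c, hac⟩ := exists_inner_add_mul_of_strongDual_prod φ
  have hU : ∀ z r, F z < r → ⟪a, z⟫ + c * r < u := fun z r hr => by
    have := hφU (z, r) ⟨Set.mem_univ _, hr⟩
    rwa [hac] at this
  have hB' : ∀ z ∈ K, u ≤ ⟪a, z⟫ + c * (F y + ⟪s, z - y⟫) := fun z hz => by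
    have := hφB (z, F y + ⟪s, z - y⟫) ⟨hz, le_rfl⟩
    rwa [hac] at this
  have huy : u ≤ ⟪a, y⟫ + c * F y := by simpa using hB' y hy
  have hc : c < 0 := by linarith [hU y (F y + 1) (by linarith)]
  have hle : ∀ z, ⟪a, z⟫ + c * F z ≤ u := by
    intro z
    have h : ∀ r, F z < r → (u - ⟪a, z⟫) / c ≤ r := fun r hr => by
      rw [div_le_iff_of_neg hc]
      linarith [hU z r hr]
    have := le_of_forall_gt_imp_ge_of_dense h
    rw [div_le_iff_of_neg hc] at this
    linarith
  have hpos : 0 < (-c)⁻¹ := inv_pos.2 (by linarith)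
  refine ⟨(-c)⁻¹ • a, fun z => ?_, fun z hz => ?_⟩
  · rw [real_inner_smul_left, inner_sub_right, ← sub_nonneg]
    have : F z - (F y + (-c)⁻¹ * (⟪a, z⟫ - ⟪a, y⟫))
        = (-c)⁻¹ * (⟪a, y⟫ + c * F y - (⟪a, z⟫ + c * F z)) := by
      have := hc.ne
      field_simp
      ring
    rw [this]
    exact mul_nonneg hpos.le (by linarith [hle z])
  · rw [inner_sub_left, real_inner_smul_left, ← neg_nonneg]
    have : -(⟪s, z - y⟫ - (-c)⁻¹ * ⟪a, z - y⟫) = (-c)⁻¹ * (⟪a, z - y⟫ + c * ⟪s, z - y⟫) := by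
      have := hc.ne
      field_simp
      ring
    rw [this, inner_sub_right a]
    exact mul_nonneg hpos.le (by linarith [hle y, hB' z hz])

end Separation

/-- The variational characterization of the projection onto a convex set. -/
theorem Convex.forall_norm_sub_le_iff_inner_nonpos {E : Type*} [NormedAddCommGroup E]
    [InnerProductSpace ℝ E] {K : Set E} (hK : Convex ℝ K) {x y : E} (hy : y ∈ K) :
    (∀ z ∈ K, ‖x - y‖ ≤ ‖x - z‖) ↔ ∀ z ∈ K, ⟪x - y, z - y⟫ ≤ 0 := by
  rw [← norm_eq_iInf_iff_real_inner_le_zero hK hy]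
  have : Nonempty K := ⟨⟨y, hy⟩⟩
  have hbdd : BddBelow (Set.range fun w : K => ‖x - w‖) :=
    ⟨0, by rintro _ ⟨_, rfl⟩; exact norm_nonneg _⟩
  refine ⟨fun h => le_antisymm (le_ciInf fun w => h w w.2) (ciInf_le hbdd ⟨y, hy⟩),
    fun h z hz => ?_⟩
  rw [h]
  exact ciInf_le hbdd ⟨z, hz⟩

section Laplacian

variable {n N : ℕ} {L : Matrix (Fin N) (Fin N) ℝ}

theorem Matrix.sum_sum_smul_eq_zero {V : Type*} [AddCommGroup V] [Module ℝ V]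
    (hsymm : L.IsSymm) (hL1 : L.mulVec (fun _ => (1 : ℝ)) = 0) (s : Fin N → V) :
    ∑ i, ∑ j, L i j • s j = 0 := by
  rw [Finset.sum_comm]
  refine Finset.sum_eq_zero fun j _ => ?_
  rw [← Finset.sum_smul]
  have h := congrFun hL1 j
  simp only [Matrix.mulVec, dotProduct, mul_one, Pi.zero_apply] at h
  simp_rw [hsymm.apply j, h, zero_smul]

theorem Matrix.exists_forall_eq_of_sum_smul_eq_zero
    (hker : ∀ x : Fin N → ℝ, L.mulVec x = 0 ↔ ∃ c : ℝ, x = fun _ => c)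
    {s : Fin N → EuclideanSpace ℝ (Fin n)} (hs : ∀ i, ∑ j, L i j • s j = 0) :
    ∃ c, ∀ i, s i = c := by
  have h : ∀ k, ∃ c : ℝ, (fun i => s i k) = fun _ => c := fun k => by
    rw [← hker]
    ext i
    simpa [Matrix.mulVec, dotProduct] using congrArg (fun v => v k) (hs i)
  choose c hc using h
  refine ⟨WithLp.toLp 2 c, fun i => ?_⟩
  ext k
  exact congrFun (hc k) i

/-- A family with zero sum lies in the range of a symmetric matrix with kernel the constants. -/
theorem Matrix.exists_sum_smul_eq_of_sum_eq_zero (hsymm : L.IsSymm)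
    (hL1 : L.mulVec (fun _ => (1 : ℝ)) = 0)
    (hker : ∀ x : Fin N → ℝ, L.mulVec x = 0 ↔ ∃ c : ℝ, x = fun _ => c)
    {b : Fin N → EuclideanSpace ℝ (Fin n)} (hb : ∑ i, b i = 0) :
    ∃ w : Fin N → EuclideanSpace ℝ (Fin n), ∀ i, ∑ j, L i j • w j = b i := by
  let T : (Fin N → EuclideanSpace ℝ (Fin n)) →ₗ[ℝ] (Fin N → EuclideanSpace ℝ (Fin n)) :=
    LinearMap.pi fun i => ∑ j, (L i j + 1) • LinearMap.proj j
  have hT : ∀ w i, T w i = ∑ j, L i j • w j + ∑ j, w j := fun w i => by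
    simp [T, add_smul, Finset.sum_add_distrib]
  have hsum : ∀ w, ∑ i, T w i = 0 → ∀ i : Fin N, ∑ j, w j = 0 := fun w hw i => by
    simp only [hT, Finset.sum_add_distrib, Matrix.sum_sum_smul_eq_zero hsymm hL1, zero_add,
      Finset.sum_const, Finset.card_univ, Fintype.card_fin, ← Nat.cast_smul_eq_nsmul ℝ] at hw
    exact (smul_eq_zero.1 hw).resolve_left (Nat.cast_ne_zero.2 i.pos.ne')
  have hinj : Function.Injective T := by
    rw [injective_iff_map_eq_zero]
    intro w hw
    have h₀ := hsum w (by simp [hw])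
    obtain ⟨c, hc⟩ := Matrix.exists_forall_eq_of_sum_smul_eq_zero hker (s := w) fun i => by
      have := hT w i
      rwa [hw, h₀ i, add_zero, Pi.zero_apply, eq_comm] at this
    ext1 i
    have := h₀ i
    simp only [hc, Finset.sum_const, Finset.card_univ, Fintype.card_fin,
      ← Nat.cast_smul_eq_nsmul ℝ] at this
    rw [hc]
    exact (smul_eq_zero.1 this).resolve_left (Nat.cast_ne_zero.2 i.pos.ne')
  obtain ⟨w, rfl⟩ := LinearMap.injective_iff_surjective.1 hinj b
  exact ⟨w, fun i => by rw [hT, hsum w hb i, add_zero]⟩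

end Laplacian

/-- Equilibrium characterization for the initialization-free distributed algorithm over
connected undirected graphs: `(y_i*)` arises from an equilibrium `(x*, s*, w*)` of the
dynamics if and only if `y*` is an optimal solution of the resource allocation problem. -/
theorem stmt_15 (n N : ℕ)
    (f : Fin N → EuclideanSpace ℝ (Fin n) → ℝ)
    (hf : ∀ i, ConvexOn ℝ Set.univ (f i))
    (Ω : Fin N → Set (EuclideanSpace ℝ (Fin n)))
    (hne : ∀ i, (Ω i).Nonempty) (hcl : ∀ i, IsClosed (Ω i)) (hconv : ∀ i, Convex ℝ (Ω i))
    (d : Fin N → EuclideanSpace ℝ (Fin n))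
    (hslater : ∃ x : Fin N → EuclideanSpace ℝ (Fin n),
      (∀ i, x i ∈ interior (Ω i)) ∧ ∑ i, x i = ∑ i, d i)
    (L : Matrix (Fin N) (Fin N) ℝ)
    (hsymm : L.IsSymm)
    (hL1 : L.mulVec (fun _ => (1 : ℝ)) = 0)
    (hker : ∀ x : Fin N → ℝ, L.mulVec x = 0 ↔ ∃ c : ℝ, x = fun _ => c)
    (k₁ k₂ k₃ : ℝ) (hk₁ : 0 < k₁) (hk₂ : 0 < k₂) (hk₃ : 0 < k₃)
    (ystar : Fin N → EuclideanSpace ℝ (Fin n)) :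
    (∃ xstar sstar wstar : Fin N → EuclideanSpace ℝ (Fin n),
      ∀ i,
        (∃ g : EuclideanSpace ℝ (Fin n),
          (∀ z, f i z ≥ f i (ystar i) + ⟪g, z - ystar i⟫) ∧
          (0 : EuclideanSpace ℝ (Fin n)) = ystar i - xstar i - g + sstar i) ∧
        (k₁ • ((∑ j, L i j • wstar j) - ystar i + d i) = k₂ • ∑ j, L i j • sstar j) ∧
        (∑ j, L i j • ((∑ l, L j l • wstar l) - ystar j + d j) = 0) ∧
        (ystar i ∈ Ω i ∧ ∀ z ∈ Ω i, ‖xstar i - ystar i‖ ≤ ‖xstar i - z‖)) ↔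
    ((∀ i, ystar i ∈ Ω i) ∧ (∑ i, ystar i = ∑ i, d i) ∧
      ∀ z : Fin N → EuclideanSpace ℝ (Fin n),
        (∀ i, z i ∈ Ω i) → ∑ i, z i = ∑ i, d i →
        ∑ i, f i (ystar i) ≤ ∑ i, f i (z i)) := by
  constructor
  · rintro ⟨x, s, w, h⟩
    have hy : ∀ i, ystar i ∈ Ω i := fun i => (h i).2.2.2.1
    obtain ⟨c, hc⟩ := Matrix.exists_forall_eq_of_sum_smul_eq_zero hker fun i => (h i).2.2.1
    have hsum : ∑ i, ((∑ j, L i j • w j) - ystar i + d i) = 0 := by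
      have h₁ : k₁ • ∑ i, ((∑ j, L i j • w j) - ystar i + d i) = 0 := by
        rw [Finset.smul_sum, Finset.sum_congr rfl fun i _ => (h i).2.1, ← Finset.smul_sum,
          Matrix.sum_sum_smul_eq_zero hsymm hL1, smul_zero]
      exact (smul_eq_zero.1 h₁).resolve_left hk₁.ne'
    have hfeas : ∑ i, ystar i = ∑ i, d i := by
      have h₁ := hsum
      rw [Finset.sum_add_distrib, Finset.sum_sub_distrib,
        Matrix.sum_sum_smul_eq_zero hsymm hL1, zero_sub, neg_add_eq_zero] at h₁
      exact h₁
    have hc₀ : ∀ i : Fin N, c = 0 := fun i => by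
      simp only [hc, Finset.sum_const, Finset.card_univ, Fintype.card_fin,
        ← Nat.cast_smul_eq_nsmul ℝ] at hsum
      exact (smul_eq_zero.1 hsum).resolve_left (Nat.cast_ne_zero.2 i.pos.ne')
    obtain ⟨σ, hσ⟩ := Matrix.exists_forall_eq_of_sum_smul_eq_zero hker (s := s) fun i => by
      have h₁ := (h i).2.1
      rw [hc i, hc₀ i, smul_zero] at h₁
      exact (smul_eq_zero.1 h₁.symm).resolve_left hk₂.ne'
    refine ⟨hy, hfeas, fun z hz hzd => ?_⟩
    have hi : ∀ i, f i (ystar i) + ⟪σ, z i - ystar i⟫ ≤ f i (z i) := by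
      intro i
      obtain ⟨⟨g, hg, h₀⟩, -, -, -, hproj⟩ := h i
      have h₁ := ((hconv i).forall_norm_sub_le_iff_inner_nonpos (hy i)).1 hproj (z i) (hz i)
      have hx : x i - ystar i = σ - g := by
        rw [← hσ i, ← sub_eq_zero, ← neg_eq_zero, h₀]
        abel
      rw [hx, inner_sub_left] at h₁
      linarith [hg (z i)]
    have h₂ := Finset.sum_le_sum fun i (_ : i ∈ Finset.univ) => hi i
    rw [Finset.sum_add_distrib, ← inner_sum, Finset.sum_sub_distrib, hzd, hfeas, sub_self,
      inner_zero_right, add_zero] at h₂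
    exact h₂
  · rintro ⟨hy, hfeas, hopt⟩
    rcases isEmpty_or_nonempty (Fin N) with hN | ⟨⟨i₀⟩⟩
    · exact ⟨0, 0, 0, fun i => hN.elim i⟩
    obtain ⟨x, hx, hxd⟩ := hslater
    let A : (Fin N → EuclideanSpace ℝ (Fin n)) →ₗ[ℝ] EuclideanSpace ℝ (Fin n) :=
      ∑ i, LinearMap.proj i
    have hA : ∀ z, A z = ∑ i, z i := fun z => by simp [A]
    have hAsurj : Function.Surjective A := fun v => ⟨Pi.single i₀ v, by simp [hA]⟩
    have hF : ConvexOn ℝ Set.univ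
        fun z : Fin N → EuclideanSpace ℝ (Fin n) => ∑ i, f i (z i) := by
      refine ⟨convex_univ, fun u _ v _ a b ha hb hab => ?_⟩
      simp only [smul_eq_mul, Finset.mul_sum, ← Finset.sum_add_distrib]
      exact Finset.sum_le_sum fun i _ => (hf i).2 trivial trivial ha hb hab
    obtain ⟨s, hs⟩ := hF.exists_lagrange_multiplier (K := Set.univ.pi Ω)
      (convex_pi fun i _ => hconv i) hAsurj (x := x) (b := ∑ i, d i) (m := ∑ i, f i (ystar i))
      (by rw [interior_pi_set Set.finite_univ]; exact fun i _ => hx i) (by rw [hA, hxd])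
      (fun z hz hzd => hopt z (fun i => hz i trivial) (by rw [← hzd, hA]))
    have hi : ∀ i, ∀ z ∈ Ω i, f i (ystar i) + ⟪s, z - ystar i⟫ ≤ f i z := by
      intro i z hz
      have h := hs (Function.update ystar i z) fun j _ => by
        rcases eq_or_ne j i with rfl | hj
        · simpa using hz
        · simpa [hj] using hy j
      have hsum : ∑ j, f j (Function.update ystar i z j) - ∑ j, f j (ystar j)
          = f i z - f i (ystar i) := by
        rw [← Finset.sum_sub_distrib, Finset.sum_eq_single i (fun j _ hj => by simp [hj])
          (by simp), Function.update_self]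
      have hd : ∑ j, Function.update ystar i z j - ∑ j, d j = z - ystar i := by
        rw [← hfeas, ← Finset.sum_sub_distrib,
          Finset.sum_eq_single i (fun j _ hj => by simp [hj]) (by simp), Function.update_self]
      rw [hA, hd] at h
      linarith
    choose g hg hgn using fun i => (hf i).exists_subgradient_of_le_on (hconv i) (hy i) (hi i)
    obtain ⟨w, hw⟩ := Matrix.exists_sum_smul_eq_of_sum_eq_zero hsymm hL1 hker
      (b := fun i => ystar i - d i) (by rw [Finset.sum_sub_distrib, hfeas, sub_self])
    have hw₀ : ∀ i, (∑ j, L i j • w j) - ystar i + d i = 0 := fun i => by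
      rw [hw]
      abel
    have hLs : ∀ i, ∑ j, L i j • s = 0 := fun i => by
      have h := congrFun hL1 i
      simp only [Matrix.mulVec, dotProduct, mul_one, Pi.zero_apply] at h
      rw [← Finset.sum_smul, h, zero_smul]
    refine ⟨fun i => ystar i - g i + s, fun _ => s, w, fun i =>
      ⟨⟨g i, hg i, by module⟩, by rw [hw₀, hLs, smul_zero, smul_zero], by simp [hw₀], hy i, ?_⟩⟩
    refine ((hconv i).forall_norm_sub_le_iff_inner_nonpos (hy i)).2 fun z hz => ?_
    have hx' : ystar i - g i + s - ystar i = s - g i := by abel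
    rw [hx']
    exact hgn i z hz
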